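/- (Bush estimate for tubes through the origin) For every ε > 0 there is a constant C_ε such that the following holds for all R ≥ 2 and all real r ≥ 3/2. Let v_1, …, v_N be unit vectors in ℝ³ with |v_i − v_j| ≥ R^{−1/2} for all i ≠ j, and for each i let T_i = { x ∈ ℝ³ : |x − (x·v_i)v_i| ≤ R^{1/2} and |x·v_i| ≤ R } be the tube of radius R^{1/2} and length 2R around the line ℝv_i through the origin. Then ‖ ∑_{i=1}^N 1_{T_i} ‖_{L^r(ℝ³)} ≤ C_ε R^{1 + 3/(2r) + ε}. -/

import Mathlib

open MeasureTheory Metric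
open scoped RealInnerProductSpace

/-- A family of points of the square `[-d, d]²`, no two of which are closer than `s` in both
coordinates, has at most `(2d/s + 2)²` members. -/
theorem card_le_of_separated_in_square {ι : Type*} (S : Finset ι) (f g : ι → ℝ) {d s : ℝ}
    (hd : 0 ≤ d) (hs : 0 < s) (hf : ∀ i ∈ S, |f i| ≤ d) (hg : ∀ i ∈ S, |g i| ≤ d)
    (hsep : ∀ i ∈ S, ∀ j ∈ S, |f i - f j| < s → |g i - g j| < s → i = j) :
    (S.card : ℝ) ≤ (2 * d / s + 2) ^ 2 := by
  set I : Finset ℤ := Finset.Icc ⌊-d / s⌋ ⌊d / s⌋ with hI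
  have hmem : ∀ y : ℝ, |y| ≤ d → ⌊y / s⌋ ∈ I := fun y hy ↦ by
    obtain ⟨h₁, h₂⟩ := abs_le.1 hy
    exact Finset.mem_Icc.2 ⟨Int.floor_le_floor (by gcongr), Int.floor_le_floor (by gcongr)⟩
  have hclose : ∀ y z : ℝ, ⌊y / s⌋ = ⌊z / s⌋ → |y - z| < s := fun y z h ↦ by
    have := Int.abs_sub_lt_one_of_floor_eq_floor h
    rwa [← sub_div, abs_div, abs_of_pos hs, div_lt_one hs] at this
  have hcard : S.card ≤ (I ×ˢ I).card := by
    refine Finset.card_le_card_of_injOn (fun i ↦ (⌊f i / s⌋, ⌊g i / s⌋)) ?_ ?_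
    · intro i hi
      exact Finset.mem_product.2 ⟨hmem _ (hf i hi), hmem _ (hg i hi)⟩
    · intro i hi j hj h
      simp only [Prod.mk.injEq] at h
      exact hsep i hi j hj (hclose _ _ h.1) (hclose _ _ h.2)
  have hIcard : (I.card : ℝ) ≤ 2 * d / s + 2 := by
    have hle : ⌊-d / s⌋ ≤ ⌊d / s⌋ + 1 := by
      have : ⌊-d / s⌋ ≤ ⌊d / s⌋ := Int.floor_le_floor (by gcongr; linarith)
      lia
    have h : (I.card : ℤ) = ⌊d / s⌋ + 1 - ⌊-d / s⌋ := Int.card_Icc_of_le _ _ hle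
    have h' : (I.card : ℝ) = ⌊d / s⌋ + 1 - ⌊-d / s⌋ := by exact_mod_cast h
    have h₁ := Int.floor_le (d / s)
    have h₂ := Int.lt_floor_add_one (-d / s)
    rw [neg_div] at h₂ h'
    rw [h', mul_div_assoc]
    linarith
  calc (S.card : ℝ) ≤ I.card * I.card := by
        rw [Finset.card_product] at hcard
        exact_mod_cast hcard
    _ ≤ (2 * d / s + 2) ^ 2 := by
        rw [sq]
        gcongr

/-- A spherical cap of `S²` on which the first coordinate is at least `1/2` is a bi-Lipschitz graph
over the plane of the other two coordinates. -/
theorem norm_sub_sq_le_of_half_le_inner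
    (b : OrthonormalBasis (Fin 3) ℝ (EuclideanSpace ℝ (Fin 3)))
    {v w : EuclideanSpace ℝ (Fin 3)} (hv : ‖v‖ = 1) (hw : ‖w‖ = 1)
    (hv₀ : 1 / 2 ≤ ⟪b 0, v⟫) (hw₀ : 1 / 2 ≤ ⟪b 0, w⟫) :
    ‖v - w‖ ^ 2 ≤ 5 * ((⟪b 1, v⟫ - ⟪b 1, w⟫) ^ 2 + (⟪b 2, v⟫ - ⟪b 2, w⟫) ^ 2) := by
  have h₁ := b.sum_sq_inner_right v
  have h₂ := b.sum_sq_inner_right w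
  have h₃ := b.sum_sq_inner_right (v - w)
  simp only [Fin.sum_univ_three, inner_sub_right, hv, hw] at h₁ h₂ h₃
  rw [← h₃]
  generalize ⟪b 0, v⟫ = a at *
  generalize ⟪b 1, v⟫ = p at *
  generalize ⟪b 2, v⟫ = q at *
  generalize ⟪b 0, w⟫ = a' at *
  generalize ⟪b 1, w⟫ = p' at *
  generalize ⟪b 2, w⟫ = q' at *
  have hprod : (a - a') * (a + a') = (p' - p) * (p + p') + (q' - q) * (q + q') := by linarith
  have hsum : (p + p') ^ 2 + (q + q') ^ 2 ≤ 4 := by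
    nlinarith [sq_nonneg (p - p'), sq_nonneg (q - q'), sq_nonneg a, sq_nonneg a']
  have hCS : ((a - a') * (a + a')) ^ 2 ≤ ((p - p') ^ 2 + (q - q') ^ 2) * 4 := by
    rw [hprod]
    calc _ ≤ ((p - p') ^ 2 + (q - q') ^ 2) * ((p + p') ^ 2 + (q + q') ^ 2) := by
          nlinarith [sq_nonneg ((p' - p) * (q + q') - (q' - q) * (p + p'))]
      _ ≤ _ := by gcongr
  have hone : (a - a') ^ 2 ≤ ((a - a') * (a + a')) ^ 2 := by
    rw [mul_pow]
    exact le_mul_of_one_le_right (sq_nonneg _) (by nlinarith)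
  linarith

theorem card_le_of_half_le_inner (b : OrthonormalBasis (Fin 3) ℝ (EuclideanSpace ℝ (Fin 3)))
    {ι : Type*} (S : Finset ι) (v : ι → EuclideanSpace ℝ (Fin 3)) {d s : ℝ}
    (hd : 0 ≤ d) (hs : 0 < s) (hv : ∀ i, ‖v i‖ = 1)
    (hsep : ∀ i j, i ≠ j → s ≤ ‖v i - v j‖) (h₀ : ∀ i ∈ S, 1 / 2 ≤ ⟪b 0, v i⟫)
    (h₁ : ∀ i ∈ S, |⟪b 1, v i⟫| ≤ d) (h₂ : ∀ i ∈ S, |⟪b 2, v i⟫| ≤ d) :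
    (S.card : ℝ) ≤ (8 * d / s + 2) ^ 2 := by
  have key := card_le_of_separated_in_square S (fun i ↦ ⟪b 1, v i⟫) (fun i ↦ ⟪b 2, v i⟫)
    (s := s / 4) hd (by positivity) h₁ h₂ ?_
  · convert key using 2
    field_simp
    ring
  · intro i hi j hj hf hg
    by_contra hij
    have hle := norm_sub_sq_le_of_half_le_inner b (hv i) (hv j) (h₀ i hi) (h₀ j hj)
    have hs' : s ^ 2 ≤ ‖v i - v j‖ ^ 2 := by gcongr; exact hsep i j hij
    have hf' := sq_lt_sq' (neg_lt_of_abs_lt hf) (lt_of_abs_lt hf)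
    have hg' := sq_lt_sq' (neg_lt_of_abs_lt hg) (lt_of_abs_lt hg)
    nlinarith [sq_pos_of_pos hs]

theorem card_le_of_half_le_abs_inner (b : OrthonormalBasis (Fin 3) ℝ (EuclideanSpace ℝ (Fin 3)))
    {ι : Type*} (S : Finset ι) (v : ι → EuclideanSpace ℝ (Fin 3)) {d s : ℝ}
    (hd : 0 ≤ d) (hs : 0 < s) (hv : ∀ i, ‖v i‖ = 1)
    (hsep : ∀ i j, i ≠ j → s ≤ ‖v i - v j‖) (h₀ : ∀ i ∈ S, 1 / 2 ≤ |⟪b 0, v i⟫|)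
    (h₁ : ∀ i ∈ S, |⟪b 1, v i⟫| ≤ d) (h₂ : ∀ i ∈ S, |⟪b 2, v i⟫| ≤ d) :
    (S.card : ℝ) ≤ 2 * (8 * d / s + 2) ^ 2 := by
  classical
  have hpos := card_le_of_half_le_inner b (S.filter fun i ↦ 0 ≤ ⟪b 0, v i⟫) v hd hs hv hsep
    (fun i hi ↦ by
      rw [Finset.mem_filter] at hi
      simpa only [abs_of_nonneg hi.2] using h₀ i hi.1)
    (fun i hi ↦ h₁ i (Finset.mem_filter.1 hi).1) (fun i hi ↦ h₂ i (Finset.mem_filter.1 hi).1)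
  have hneg := card_le_of_half_le_inner b (S.filter fun i ↦ ¬ 0 ≤ ⟪b 0, v i⟫) (fun i ↦ -v i) hd hs
    (fun i ↦ by rw [norm_neg, hv])
    (fun i j hij ↦ by
      rw [neg_sub_neg, norm_sub_rev]
      exact hsep i j hij)
    (fun i hi ↦ by
      rw [Finset.mem_filter, not_le] at hi
      simpa only [inner_neg_right, abs_of_neg hi.2] using h₀ i hi.1)
    (fun i hi ↦ by
      simpa only [inner_neg_right, abs_neg] using h₁ i (Finset.mem_filter.1 hi).1)
    (fun i hi ↦ by
      simpa only [inner_neg_right, abs_neg] using h₂ i (Finset.mem_filter.1 hi).1)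
  have hcard := Finset.card_filter_add_card_filter_not (s := S) fun i ↦ 0 ≤ ⟪b 0, v i⟫
  rw [← hcard, Nat.cast_add]
  linarith

/-- An `s`-separated subset of `S²` has `O(s⁻²)` elements. -/
theorem card_le_of_separated_on_sphere {ι : Type*} (S : Finset ι)
    (v : ι → EuclideanSpace ℝ (Fin 3)) {s : ℝ} (hs : 0 < s) (hs₁ : s ≤ 1) (hv : ∀ i, ‖v i‖ = 1)
    (hsep : ∀ i j, i ≠ j → s ≤ ‖v i - v j‖) : (S.card : ℝ) ≤ 600 / s ^ 2 := by
  classical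
  let e := EuclideanSpace.basisFun (Fin 3) ℝ
  have hpart : ∀ k : Fin 3,
      ((S.filter fun i ↦ 1 / 2 ≤ |⟪e k, v i⟫|).card : ℝ) ≤ 2 * (8 * 1 / s + 2) ^ 2 := by
    intro k
    have hle : ∀ (l : Fin 3) (i : ι), |⟪e l, v i⟫| ≤ 1 := fun l i ↦ by
      simpa [e.orthonormal.1 l, hv i] using abs_real_inner_le_norm (e l) (v i)
    refine card_le_of_half_le_abs_inner (e.reindex (Equiv.swap 0 k)) _ v zero_le_one hs hv hsep
      ?_ ?_ ?_
    · intro i hi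
      simpa [OrthonormalBasis.reindex_apply] using (Finset.mem_filter.1 hi).2
    all_goals
      intro i _
      rw [OrthonormalBasis.reindex_apply]
      exact hle _ _
  have hcover : S ⊆ Finset.univ.biUnion fun k : Fin 3 ↦ S.filter fun i ↦ 1 / 2 ≤ |⟪e k, v i⟫| := by
    intro i hi
    simp only [Finset.mem_biUnion, Finset.mem_univ, true_and, Finset.mem_filter, hi]
    by_contra! h
    have hsum := e.sum_sq_inner_right (v i)
    rw [hv i, Fin.sum_univ_three] at hsum
    have hsq : ∀ k, ⟪e k, v i⟫ ^ 2 < (1 / 2) ^ 2 := fun k ↦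
      sq_lt_sq' (neg_lt_of_abs_lt (h k)) (lt_of_abs_lt (h k))
    linarith [hsq 0, hsq 1, hsq 2]
  have hcard : (S.card : ℝ) ≤
      ∑ k : Fin 3, ((S.filter fun i ↦ 1 / 2 ≤ |⟪e k, v i⟫|).card : ℝ) := by
    exact_mod_cast (Finset.card_le_card hcover).trans Finset.card_biUnion_le
  calc (S.card : ℝ) ≤ _ := hcard
    _ ≤ ∑ k : Fin 3, 2 * (8 * 1 / s + 2) ^ 2 := Finset.sum_le_sum fun k _ ↦ hpart k
    _ = 6 * (8 / s + 2) ^ 2 := by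
      rw [Fin.sum_univ_three]
      ring
    _ ≤ 6 * (10 / s) ^ 2 := by
      have : 1 ≤ 1 / s := (one_le_div hs).2 hs₁
      gcongr
      linarith [show (10 : ℝ) / s = 8 / s + 2 * (1 / s) by ring]
    _ = 600 / s ^ 2 := by ring

/-- Directions of lines through the origin that pass within `ρ` of `x` lie in a double cap around
`x / ‖x‖`, of radius `ρ / ‖x‖`. -/
theorem card_le_of_norm_sub_inner_smul_le {ι : Type*} (S : Finset ι)
    (v : ι → EuclideanSpace ℝ (Fin 3)) {s ρ : ℝ} (hs : 0 < s) (hρ : 0 ≤ ρ) (hv : ∀ i, ‖v i‖ = 1)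
    (hsep : ∀ i j, i ≠ j → s ≤ ‖v i - v j‖) {x : EuclideanSpace ℝ (Fin 3)} (hx₀ : x ≠ 0)
    (hx : 2 * ρ ≤ ‖x‖) (hS : ∀ i ∈ S, ‖x - ⟪x, v i⟫ • v i‖ ≤ ρ) :
    (S.card : ℝ) ≤ 2 * (8 * (ρ / ‖x‖) / s + 2) ^ 2 := by
  have hx' : 0 < ‖x‖ := norm_pos_iff.2 hx₀
  set u := ‖x‖⁻¹ • x with hu
  have hunit : ‖u‖ = 1 := norm_smul_inv_norm hx₀
  obtain ⟨b, hb⟩ := Orthonormal.exists_orthonormalBasis_extension_of_card_eq (𝕜 := ℝ)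
    (E := EuclideanSpace ℝ (Fin 3)) (ι := Fin 3) (by simp) (v := fun _ ↦ u) (s := {0}) (by
      rw [orthonormal_iff_ite]
      rintro ⟨i, rfl⟩ ⟨j, rfl⟩
      simp [hunit])
  have hb₀ : b 0 = u := hb 0 rfl
  have hd : ρ / ‖x‖ ≤ 1 / 2 := by rw [div_le_iff₀ hx']; linarith
  have hd₀ : 0 ≤ ρ / ‖x‖ := by positivity
  have hcap : ∀ i ∈ S, 1 - ⟪b 0, v i⟫ ^ 2 ≤ (ρ / ‖x‖) ^ 2 := by
    intro i hi
    have hdist : ‖x - ⟪x, v i⟫ • v i‖ ^ 2 = ‖x‖ ^ 2 - ⟪x, v i⟫ ^ 2 := by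
      rw [norm_sub_sq_real, inner_smul_right, norm_smul, hv i, mul_one, Real.norm_eq_abs, sq_abs]
      ring
    have hle : ‖x - ⟪x, v i⟫ • v i‖ ^ 2 ≤ ρ ^ 2 := by gcongr; exact hS i hi
    rw [hb₀, hu, real_inner_smul_left, div_pow, le_div_iff₀ (by positivity)]
    field_simp
    linarith
  have hsum : ∀ i, ⟪b 0, v i⟫ ^ 2 + ⟪b 1, v i⟫ ^ 2 + ⟪b 2, v i⟫ ^ 2 = 1 := fun i ↦ by
    have := b.sum_sq_inner_right (v i)
    rwa [hv i, Fin.sum_univ_three, one_pow] at this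
  refine card_le_of_half_le_abs_inner b S v hd₀ hs hv hsep ?_ ?_ ?_ <;> intro i hi
  · have : (1 / 2 : ℝ) ^ 2 ≤ ⟪b 0, v i⟫ ^ 2 := by nlinarith [hcap i hi]
    simpa using sq_le_sq.1 this
  · exact abs_le_of_sq_le_sq (by nlinarith [hcap i hi, hsum i, sq_nonneg ⟪b 2, v i⟫]) hd₀
  · exact abs_le_of_sq_le_sq (by nlinarith [hcap i hi, hsum i, sq_nonneg ⟪b 1, v i⟫]) hd₀

/-- The multiplicity of a bush of tubes of radius `q` and length `2q²` with `q⁻¹`-separated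
directions, at a point `x`. -/
theorem card_tubes_le_div_norm_sq {ι : Type*} (S : Finset ι) (v : ι → EuclideanSpace ℝ (Fin 3))
    {q : ℝ} (hq : 1 ≤ q) (hv : ∀ i, ‖v i‖ = 1) (hsep : ∀ i j, i ≠ j → q⁻¹ ≤ ‖v i - v j‖)
    {x : EuclideanSpace ℝ (Fin 3)} (hx₀ : x ≠ 0) (hx : ‖x‖ ≤ 2 * q ^ 2)
    (hS : ∀ i ∈ S, ‖x - ⟪x, v i⟫ • v i‖ ≤ q) : (S.card : ℝ) ≤ 2400 * (q ^ 2 / ‖x‖) ^ 2 := by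
  have hx' : 0 < ‖x‖ := norm_pos_iff.2 hx₀
  have hq₀ : 0 < q := by linarith
  rcases le_total (2 * q) ‖x‖ with h | h
  · calc (S.card : ℝ) ≤ 2 * (8 * (q / ‖x‖) / q⁻¹ + 2) ^ 2 :=
          card_le_of_norm_sub_inner_smul_le S v (by positivity) hq₀.le hv hsep hx₀ h hS
      _ ≤ 2 * (12 * (q ^ 2 / ‖x‖)) ^ 2 := by
          have h₁ : 1 / 2 ≤ q ^ 2 / ‖x‖ := by rw [le_div_iff₀ hx']; linarith
          have h₂ : 8 * (q / ‖x‖) / q⁻¹ = 8 * (q ^ 2 / ‖x‖) := by field_simp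
          rw [h₂]
          gcongr
          linarith
      _ ≤ 2400 * (q ^ 2 / ‖x‖) ^ 2 := by nlinarith [sq_nonneg (q ^ 2 / ‖x‖)]
  · calc (S.card : ℝ) ≤ 600 / q⁻¹ ^ 2 :=
          card_le_of_separated_on_sphere S v (by positivity) (inv_le_one_of_one_le₀ hq) hv hsep
      _ = 2400 * (q / 2) ^ 2 := by field_simp; norm_num
      _ ≤ 2400 * (q ^ 2 / ‖x‖) ^ 2 := by
          have : q / 2 ≤ q ^ 2 / ‖x‖ := by
            rw [div_le_div_iff₀ two_pos hx']
            nlinarith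
          gcongr

theorem sq_smul_indicator_rpow (M η : ℝ) :
    Set.EqOn (fun y : ℝ ↦ y ^ (Module.finrank ℝ (EuclideanSpace ℝ (Fin 3)) - 1) •
      (Set.Iic M).indicator (fun t ↦ t ^ (η - 3)) y)
      ((Set.Iic M).indicator fun t ↦ t ^ (η - 1)) (Set.Ioi 0) := by
  intro y hy
  by_cases hyM : y ∈ Set.Iic M
  · simp only [finrank_euclideanSpace, Fintype.card_fin, Set.indicator_of_mem hyM, smul_eq_mul]
    rw [← Real.rpow_natCast, ← Real.rpow_add hy]
    norm_num
    ring_nf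
  · simp [Set.indicator_of_notMem hyM]

theorem integrable_indicator_norm_rpow {η M : ℝ} (hη : 0 < η) (hM : 0 ≤ M) :
    Integrable fun x : EuclideanSpace ℝ (Fin 3) ↦
      (Set.Iic M).indicator (fun t : ℝ ↦ t ^ (η - 3)) ‖x‖ := by
  rw [integrable_fun_norm_addHaar volume (f := (Set.Iic M).indicator fun t : ℝ ↦ t ^ (η - 3)),
    integrableOn_congr_fun (sq_smul_indicator_rpow M η) measurableSet_Ioi, IntegrableOn,
    integrable_indicator_iff measurableSet_Iic, IntegrableOn,
    Measure.restrict_restrict measurableSet_Iic, Set.Iic_inter_Ioi, ← IntegrableOn,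
    ← intervalIntegrable_iff_integrableOn_Ioc_of_le hM]
  exact intervalIntegral.intervalIntegrable_rpow' (by linarith)

theorem integral_indicator_norm_rpow {η M : ℝ} (hη : 0 < η) (hM : 0 ≤ M) :
    ∫ x : EuclideanSpace ℝ (Fin 3), (Set.Iic M).indicator (fun t : ℝ ↦ t ^ (η - 3)) ‖x‖ =
      3 * volume.real (ball (0 : EuclideanSpace ℝ (Fin 3)) 1) * (M ^ η / η) := by
  rw [integral_fun_norm_addHaar volume ((Set.Iic M).indicator fun t : ℝ ↦ t ^ (η - 3)),
    setIntegral_congr_fun measurableSet_Ioi (sq_smul_indicator_rpow M η),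
    integral_indicator measurableSet_Iic,
    Measure.restrict_restrict measurableSet_Iic, Set.Iic_inter_Ioi,
    ← intervalIntegral.integral_of_le hM, integral_rpow (Or.inl (by linarith))]
  simp [Real.zero_rpow hη.ne', mul_assoc]

/-- Interpolation between the two multiplicity bounds `y ≤ A R` and `y ≤ A (R / t)²`. -/
theorem rpow_le_of_le_mul_of_le_mul_div_sq {A R r η t y : ℝ} (hA : 0 < A) (hR : 0 < R)
    (hr : 3 / 2 ≤ r) (hη : 0 < η) (hη₁ : η ≤ 1) (ht : 0 < t) (hy : 0 ≤ y) (hyR : y ≤ A * R)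
    (hyt : y ≤ A * (R / t) ^ 2) : y ^ r ≤ A ^ r * R ^ (r + 3 / 2 - η / 2) * t ^ (η - 3) := by
  set z := y / A with hz
  have hz₀ : 0 ≤ z := by positivity
  have hzR : z ≤ R := by rw [hz, div_le_iff₀' hA]; exact hyR
  have hzt : z ≤ (R / t) ^ 2 := by rw [hz, div_le_iff₀' hA]; exact hyt
  have hyz : y = A * z := by rw [hz]; field_simp
  have hzr : z ^ r ≤ R ^ (r + 3 / 2 - η / 2) * t ^ (η - 3) :=
    calc z ^ r = z ^ (r - 3 / 2 + η / 2) * z ^ ((3 - η) / 2) := by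
          rw [← Real.rpow_add_of_nonneg hz₀ (by linarith) (by linarith)]
          ring_nf
      _ ≤ R ^ (r - 3 / 2 + η / 2) * ((R / t) ^ 2) ^ ((3 - η) / 2) := by
          gcongr; linarith
      _ = R ^ (r - 3 / 2 + η / 2) * (R ^ (3 - η) * t ^ (η - 3)) := by
          rw [← Real.rpow_natCast, ← Real.rpow_mul (by positivity), Real.div_rpow hR.le ht.le,
            div_eq_mul_inv (R ^ _), ← Real.rpow_neg ht.le]
          push_cast
          ring_nf
      _ = R ^ (r + 3 / 2 - η / 2) * t ^ (η - 3) := by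
          rw [← mul_assoc, ← Real.rpow_add hR]
          ring_nf
  rw [hyz, Real.mul_rpow hA.le hz₀, mul_assoc]
  gcongr

/-- Bush estimate for tubes through the origin: for `1/√R`-separated
directions `v_i`, the tubes `T_i` of radius `√R` and length `2R` around the lines
`ℝv_i` satisfy `‖∑ 1_{T_i}‖_{L^r(ℝ³)} ≤ C_ε R^{1 + 3/(2r) + ε}` for every `r ≥ 3/2`. -/
theorem stmt19 :
    ∀ ε > (0 : ℝ), ∃ C > (0 : ℝ), ∀ R : ℝ, 2 ≤ R → ∀ r : ℝ, 3 / 2 ≤ r →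
      ∀ (N : ℕ) (v : Fin N → EuclideanSpace ℝ (Fin 3)),
      (∀ i, ‖v i‖ = 1) →
      (∀ i j, i ≠ j → R ^ (-(1 : ℝ) / 2) ≤ ‖v i - v j‖) →
      ∀ T : Fin N → Set (EuclideanSpace ℝ (Fin 3)),
      (∀ i, T i = {x : EuclideanSpace ℝ (Fin 3) |
        ‖x - ⟪x, v i⟫ • v i‖ ≤ R ^ ((1 : ℝ) / 2) ∧ |⟪x, v i⟫| ≤ R}) →
      (∫ x : EuclideanSpace ℝ (Fin 3),
          (∑ i : Fin N, (T i).indicator (fun _ => (1 : ℝ)) x) ^ r) ^ (1 / r) ≤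
        C * R ^ (1 + 3 / (2 * r) + ε) := by
  intro ε hε
  set η := min ε 1 with hη
  have hη₀ : 0 < η := lt_min hε one_pos
  have hη₁ : η ≤ 1 := min_le_right _ _
  have hηε : η ≤ ε := min_le_left _ _
  set B := volume.real (ball (0 : EuclideanSpace ℝ (Fin 3)) 1) with hB
  set K := max 1 (6 * B / η) with hK
  have hK₁ : 1 ≤ K := le_max_left _ _
  refine ⟨2400 * K, by positivity, ?_⟩
  intro R hR r hr N v hv hsep T hT
  have hR₀ : 0 < R := by linarith
  have hr₀ : 0 < r := by linarith
  set q := R ^ ((1 : ℝ) / 2) with hq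
  have hqR : q ^ 2 = R := by
    rw [hq, ← Real.rpow_natCast, ← Real.rpow_mul hR₀.le]
    norm_num
  have hq₁ : 1 ≤ q := Real.one_le_rpow (by linarith) (by norm_num)
  have hqinv : R ^ (-(1 : ℝ) / 2) = q⁻¹ := by rw [hq, ← Real.rpow_neg hR₀.le, neg_div]
  rw [hqinv] at hsep
  set F : EuclideanSpace ℝ (Fin 3) → ℝ :=
    fun x ↦ ∑ i : Fin N, (T i).indicator (fun _ => (1 : ℝ)) x with hF
  have hF₀ : ∀ x, 0 ≤ F x := fun x ↦
    Finset.sum_nonneg fun i _ ↦ Set.indicator_nonneg (fun _ _ ↦ zero_le_one) x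
  have hFcard : ∀ x, ∃ S : Finset (Fin N), F x = S.card ∧ ∀ i ∈ S, x ∈ T i := fun x ↦ by
    classical
    refine ⟨Finset.univ.filter fun i ↦ x ∈ T i, ?_, fun i hi ↦ (Finset.mem_filter.1 hi).2⟩
    simp [hF, Set.indicator_apply]
  have hbound : ∀ x : EuclideanSpace ℝ (Fin 3), x ≠ 0 → F x ^ r ≤
      2400 ^ r * R ^ (r + 3 / 2 - η / 2) *
        (Set.Iic (2 * R)).indicator (fun t : ℝ ↦ t ^ (η - 3)) ‖x‖ := by
    intro x hx₀
    obtain ⟨S, hFS, hS⟩ := hFcard x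
    have hST : ∀ i ∈ S, ‖x - ⟪x, v i⟫ • v i‖ ≤ q ∧ |⟪x, v i⟫| ≤ R := fun i hi ↦ by
      have := hS i hi
      rwa [hT i] at this
    by_cases hx : ‖x‖ ≤ 2 * R
    · rw [Set.indicator_of_mem (show ‖x‖ ∈ Set.Iic (2 * R) from hx)]
      refine rpow_le_of_le_mul_of_le_mul_div_sq (by norm_num) hR₀ hr hη₀ hη₁
        (norm_pos_iff.2 hx₀) (hF₀ x) ?_ ?_
      · rw [hFS]
        have := card_le_of_separated_on_sphere S v (s := q⁻¹) (by positivity)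
          (inv_le_one_of_one_le₀ hq₁) hv hsep
        rw [inv_pow, div_inv_eq_mul, hqR] at this
        linarith
      · rw [hFS, ← hqR]
        exact card_tubes_le_div_norm_sq S v hq₁ hv hsep hx₀ (by rwa [hqR])
          fun i hi ↦ (hST i hi).1
    · have hempty : S = ∅ := by
        refine Finset.eq_empty_of_forall_notMem fun i hi ↦ hx ?_
        obtain ⟨h₁, h₂⟩ := hST i hi
        calc ‖x‖ = ‖(x - ⟪x, v i⟫ • v i) + ⟪x, v i⟫ • v i‖ := by rw [sub_add_cancel]
          _ ≤ ‖x - ⟪x, v i⟫ • v i‖ + ‖⟪x, v i⟫ • v i‖ := norm_add_le _ _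
          _ ≤ q + R := by
            rw [norm_smul, hv i, mul_one]
            exact add_le_add h₁ h₂
          _ ≤ 2 * R := by nlinarith
      rw [hFS, hempty, Set.indicator_of_notMem (by simpa using hx)]
      simp [Real.zero_rpow hr₀.ne']
  have hint : ∫ x, F x ^ r ≤ 2400 ^ r * K * R ^ (r + 3 / 2 + η / 2) := by
    calc ∫ x, F x ^ r ≤ ∫ x : EuclideanSpace ℝ (Fin 3), 2400 ^ r * R ^ (r + 3 / 2 - η / 2) *
          (Set.Iic (2 * R)).indicator (fun t : ℝ ↦ t ^ (η - 3)) ‖x‖ := by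
          refine integral_mono_of_nonneg (.of_forall fun x ↦ Real.rpow_nonneg (hF₀ x) r)
            ((integrable_indicator_norm_rpow hη₀ (by positivity)).const_mul _) ?_
          filter_upwards [Measure.ae_ne volume 0] with x hx using hbound x hx
      _ = 2400 ^ r * R ^ (r + 3 / 2 - η / 2) * (3 * B * ((2 * R) ^ η / η)) := by
          rw [integral_const_mul, integral_indicator_norm_rpow hη₀ (by positivity)]
      _ ≤ 2400 ^ r * R ^ (r + 3 / 2 - η / 2) * (K * R ^ η) := by
          have h2 : (2 : ℝ) ^ η ≤ 2 := by
            simpa using Real.rpow_le_rpow_of_exponent_le one_le_two hη₁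
          have hle : 3 * B * ((2 * R) ^ η / η) ≤ 6 * B / η * R ^ η := by
            rw [Real.mul_rpow zero_le_two hR₀.le]
            calc 3 * B * (2 ^ η * R ^ η / η) ≤ 3 * B * (2 * R ^ η / η) := by gcongr
              _ = 6 * B / η * R ^ η := by ring
          have hle' : 6 * B / η * R ^ η ≤ K * R ^ η := by gcongr; exact le_max_right _ _
          exact mul_le_mul_of_nonneg_left (hle.trans hle') (by positivity)
      _ = 2400 ^ r * K * R ^ (r + 3 / 2 + η / 2) := by
          rw [show r + 3 / 2 + η / 2 = (r + 3 / 2 - η / 2) + η by ring, Real.rpow_add hR₀]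
          ring
  have hr₁ : 1 / r ≤ 1 := by rw [div_le_one hr₀]; linarith
  calc (∫ x, F x ^ r) ^ (1 / r) ≤ (2400 ^ r * K * R ^ (r + 3 / 2 + η / 2)) ^ (1 / r) := by
        gcongr
        exact integral_nonneg fun x ↦ Real.rpow_nonneg (hF₀ x) r
    _ = 2400 * K ^ (1 / r) * R ^ ((r + 3 / 2 + η / 2) * (1 / r)) := by
        rw [Real.mul_rpow (by positivity) (by positivity), Real.mul_rpow (by positivity)
          (by positivity), ← Real.rpow_mul (by norm_num), ← Real.rpow_mul hR₀.le,
          mul_one_div_cancel hr₀.ne', Real.rpow_one]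
    _ ≤ 2400 * K * R ^ (1 + 3 / (2 * r) + ε) := by
        have hKr : K ^ (1 / r) ≤ K := by
          simpa using Real.rpow_le_rpow_of_exponent_le hK₁ hr₁
        have hexp : (r + 3 / 2 + η / 2) * (1 / r) ≤ 1 + 3 / (2 * r) + ε := by
          have h₁ : (r + 3 / 2 + η / 2) * (1 / r) = 1 + 3 / (2 * r) + η / 2 * (1 / r) := by
            field_simp
          have h₂ : η / 2 * (1 / r) ≤ η / 2 := mul_le_of_le_one_right (by positivity) hr₁
          linarith
        gcongr
        linarith
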